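/- arXiv:2502.08740 — 3 statements merged into one kernel-verified Lean document; each statement's English description precedes it below -/
import Mathlib

section
/- Let T > 0, c_M > 0, and let σ_A, σ_S : (0,∞) → [0,∞) be measurable. Suppose ω, k ∈ ℂ, δT ∈ ℂ, and a measurable δf : ℝ³∖{0} → ℂ satisfy the plane-wave radiative transfer system (i)–(ii) with the finiteness assumptions as in Theorem 2, and set N = c_M|δT|²/T² + ∫_{ℝ³} w(|p|)|δf(p)|² d³p. If N > 0, then ω = k·A − i·B, where A = (1/N)·∫_{ℝ³} w(|p|)|δf(p)|² (p¹/|p|) d³p (a real number with |A| ≤ 1) and B = (1/N)·∫_{ℝ³} w(|p|)[σ_A(|p|)|δf_BB(|p|) − δf(p)|² + σ_S(|p|)|δf̄(|p|) − δf(p)|²] d³p (a nonnegative real number). -/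
/-! Statement 1: explicit formula ω = k·A − i·B for plane-wave solutions of the
linearized radiative transfer system, with |A| ≤ 1 and B ≥ 0. -/

noncomputable section
open MeasureTheory Real Set

/-- Physical momentum space `ℝ³`. -/
abbrev R3 : Type := EuclideanSpace ℝ (Fin 3)

/-- Black-body occupation number `f_BB(q) = 1/(e^{q/T} - 1)`. -/
def fBB (T q : ℝ) : ℝ := 1 / (Real.exp (q / T) - 1)

/-- Entropy weight `w(q) = 2 / ((2π)³ f_BB(q)(1 + f_BB(q)))`. -/
def wgt (T q : ℝ) : ℝ := 2 / ((2 * Real.pi) ^ 3 * (fBB T q * (1 + fBB T q)))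

/-- Perturbation of the black-body distribution,
`δf_BB(q) = f_BB(q)(1 + f_BB(q)) q δT / T²`. -/
def δfBB (T : ℝ) (δT : ℂ) (q : ℝ) : ℂ :=
  ((fBB T q * (1 + fBB T q) * q / T ^ 2 : ℝ) : ℂ) * δT

/-- Average of `δf` over the unit sphere of directions at energy `q`:
`δf̄(q) = (1/(4π)) ∫_{S²} δf(qΩ) dσ(Ω)`. -/
def sphAvg (δf : R3 → ℂ) (q : ℝ) : ℂ :=
  (4 * Real.pi : ℝ)⁻¹ •
    ∫ Ω : Metric.sphere (0 : R3) 1, δf (q • (Ω : R3)) ∂((volume : Measure R3).toSphere)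

/-- The collision term
`σ_A(|p|)(δf_BB(|p|) − δf(p)) + σ_S(|p|)(δf̄(|p|) − δf(p))`. -/
def coll (σA σS : ℝ → ℝ) (T : ℝ) (δT : ℂ) (δf : R3 → ℂ) (p : R3) : ℂ :=
  (σA ‖p‖ : ℝ) * (δfBB T δT ‖p‖ - δf p) + (σS ‖p‖ : ℝ) * (sphAvg δf ‖p‖ - δf p)

open scoped ComplexConjugate

theorem integral_eq_zero_of_forall_integral_sphere_eq_zero {f : R3 → ℂ}
    (h : ∀ r : ℝ, 0 < r →
      ∫ Ω : Metric.sphere (0 : R3) 1, f (r • (Ω : R3)) ∂(volume : Measure R3).toSphere = 0) :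
    ∫ p : R3, f p = 0 := by
  by_cases hf : Integrable f
  swap
  · exact integral_undef hf
  have hmp := (volume : Measure R3).measurePreserving_homeomorphUnitSphereProd
  have hemb := (homeomorphUnitSphereProd R3).measurableEmbedding
  set g : Metric.sphere (0 : R3) 1 × Ioi (0 : ℝ) → ℂ := fun x ↦ f ((x.2 : ℝ) • (x.1 : R3))
    with hg
  have hcomp : g ∘ homeomorphUnitSphereProd R3 = fun x : ({0}ᶜ : Set R3) ↦ f x := by
    funext x
    have hx : ‖(x : R3)‖ ≠ 0 := norm_ne_zero_iff.mpr x.2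
    simp [hg, smul_smul, hx]
  have hgi : Integrable g ((volume : Measure R3).toSphere.prod
      (Measure.volumeIoiPow (Module.finrank ℝ R3 - 1))) := by
    rw [← hmp.integrable_comp_emb hemb, hcomp]
    exact (integrableOn_iff_comap_subtypeVal (measurableSet_singleton (0 : R3)).compl).mp
      hf.integrableOn
  calc ∫ p : R3, f p
      = ∫ x : ({0}ᶜ : Set R3), f x ∂((volume : Measure R3).comap Subtype.val) := by
        rw [integral_subtype_comap (measurableSet_singleton _).compl fun x ↦ f x,
          restrict_compl_singleton]
    _ = ∫ x, g x ∂((volume : Measure R3).toSphere.prod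
          (Measure.volumeIoiPow (Module.finrank ℝ R3 - 1))) := by
        rw [← hmp.integral_comp hemb]
        exact congrArg (fun F ↦ integral _ F) hcomp.symm
    _ = 0 := by
        rw [integral_prod_symm _ hgi]
        exact integral_eq_zero_of_ae (.of_forall fun r ↦ h r r.2)

theorem toSphere_real_univ_R3 :
    (volume : Measure R3).toSphere.real univ = 4 * Real.pi := by
  rw [Measure.toSphere_real_apply_univ, Measure.real, EuclideanSpace.volume_ball_fin_three]
  have : 0 ≤ Real.pi * 4 / 3 := by positivity
  simp [ENNReal.toReal_ofReal this]
  ring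

theorem integral_sphAvg_sub (δf : R3 → ℂ) (r : ℝ) :
    ∫ Ω : Metric.sphere (0 : R3) 1, (sphAvg δf r - δf (r • (Ω : R3)))
      ∂(volume : Measure R3).toSphere = 0 := by
  by_cases hf : Integrable (fun Ω : Metric.sphere (0 : R3) 1 ↦ δf (r • (Ω : R3)))
      (volume : Measure R3).toSphere
  · rw [integral_sub (integrable_const _) hf, integral_const, toSphere_real_univ_R3, sphAvg,
      smul_inv_smul₀ (by positivity), sub_self]
  · refine integral_undef fun hsub ↦ hf ?_
    simpa [Pi.sub_def] using (integrable_const (sphAvg δf r)).sub hsub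

theorem integral_radial_mul_sphAvg_sub (h : ℝ → ℂ) (δf : R3 → ℂ) :
    ∫ p : R3, h ‖p‖ * (sphAvg δf ‖p‖ - δf p) = 0 := by
  refine integral_eq_zero_of_forall_integral_sphere_eq_zero fun r hr ↦ ?_
  have hn (Ω : Metric.sphere (0 : R3) 1) : ‖r • (Ω : R3)‖ = r := by
    simp [norm_smul, abs_of_pos hr]
  simp_rw [hn]
  rw [integral_const_mul, integral_sphAvg_sub, mul_zero]

theorem fBB_nonneg {T q : ℝ} (hT : 0 < T) (hq : 0 ≤ q) : 0 ≤ fBB T q := by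
  have : 1 ≤ Real.exp (q / T) := Real.one_le_exp (by positivity)
  exact div_nonneg zero_le_one (sub_nonneg.mpr this)

theorem wgt_nonneg {T q : ℝ} (hT : 0 < T) (hq : 0 ≤ q) : 0 ≤ wgt T q := by
  have := fBB_nonneg hT hq
  unfold wgt
  positivity

theorem wgt_zero (T : ℝ) : wgt T 0 = 0 := by simp [wgt, fBB]

theorem wgt_mul_δfBB {T q : ℝ} (hT : 0 < T) (hq : 0 ≤ q) (δT : ℂ) :
    (wgt T q : ℂ) * δfBB T δT q = ((2 / (2 * Real.pi) ^ 3 * q : ℝ) : ℂ) * (δT / (T : ℂ) ^ 2) := by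
  have key : wgt T q * (fBB T q * (1 + fBB T q) * q / T ^ 2) =
      2 / (2 * Real.pi) ^ 3 * q / T ^ 2 := by
    rcases hq.eq_or_lt with rfl | hq
    · simp
    have hexp : 1 < Real.exp (q / T) := Real.one_lt_exp_iff.mpr (by positivity)
    have hf : 0 < fBB T q := div_pos one_pos (sub_pos.mpr hexp)
    have hf1 : 1 + fBB T q ≠ 0 := by positivity
    unfold wgt
    field_simp
  rw [δfBB, ← mul_assoc, ← Complex.ofReal_mul, key]
  push_cast
  ring

theorem abs_coord_div_norm_le_one (p : R3) (i : Fin 3) : |p i / ‖p‖| ≤ 1 := by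
  rw [abs_div, abs_norm]
  exact div_le_one_of_le₀ (by simpa using PiLp.norm_apply_le p i) (norm_nonneg p)

theorem collision_entropy_identity {w sA sS : ℝ} {F b a : ℂ} :
    (w : ℂ) * conj (b - F) * (sA * (b - F) + sS * (a - F)) =
      ((w * sA * ‖b - F‖ ^ 2 : ℝ) : ℂ) + ((w * sS * ‖a - F‖ ^ 2 : ℝ) : ℂ) +
        (w : ℂ) * sS * conj (b - a) * (a - F) := by
  push_cast
  rw [← Complex.conj_mul' (b - F), ← Complex.conj_mul' (a - F)]
  simp only [map_sub]
  ring

theorem radiative_transfer_omega_formula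
    (T cM : ℝ) (hT : 0 < T) (hcM : 0 < cM)
    (σA σS : ℝ → ℝ) (hσAm : Measurable σA) (hσSm : Measurable σS)
    (hσA : ∀ q ∈ Ioi (0 : ℝ), 0 ≤ σA q) (hσS : ∀ q ∈ Ioi (0 : ℝ), 0 ≤ σS q)
    (ω k : ℂ) (δT : ℂ) (δf : R3 → ℂ) (hδf : Measurable δf)
    -- equation (i): energy conservation
    (heq1 : -Complex.I * cM * ω * δT =
      -∫ p : R3, ((2 / (2 * Real.pi) ^ 3 * ‖p‖ : ℝ) : ℂ) * coll σA σS T δT δf p)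
    -- equation (ii): Boltzmann equation, for a.e. p
    (heq2 : ∀ᵐ p : R3, -Complex.I * (ω - k * ((p 0 / ‖p‖ : ℝ) : ℂ)) * δf p =
      coll σA σS T δT δf p)
    -- finiteness assumptions
    (hInt1 : Integrable (fun p : R3 => wgt T ‖p‖ * ‖δf p‖ ^ 2))
    (hInt2 : Integrable (fun p : R3 => wgt T ‖p‖ * σA ‖p‖ * ‖δfBB T δT ‖p‖ - δf p‖ ^ 2))
    (hInt3 : Integrable (fun p : R3 => wgt T ‖p‖ * σS ‖p‖ * ‖sphAvg δf ‖p‖ - δf p‖ ^ 2))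
    (hInt4 : Integrable (fun p : R3 =>
      ((2 / (2 * Real.pi) ^ 3 * ‖p‖ : ℝ) : ℂ) * coll σA σS T δT δf p))
    -- nondegeneracy: N > 0
    (hN : 0 < cM * ‖δT‖ ^ 2 / T ^ 2 + ∫ p : R3, wgt T ‖p‖ * ‖δf p‖ ^ 2) :
    ω = k * ((cM * ‖δT‖ ^ 2 / T ^ 2 + ∫ p : R3, wgt T ‖p‖ * ‖δf p‖ ^ 2)⁻¹ *
          ∫ p : R3, wgt T ‖p‖ * ‖δf p‖ ^ 2 * (p 0 / ‖p‖) : ℝ)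
        - Complex.I * ((cM * ‖δT‖ ^ 2 / T ^ 2 + ∫ p : R3, wgt T ‖p‖ * ‖δf p‖ ^ 2)⁻¹ *
          ∫ p : R3, wgt T ‖p‖ * (σA ‖p‖ * ‖δfBB T δT ‖p‖ - δf p‖ ^ 2 +
            σS ‖p‖ * ‖sphAvg δf ‖p‖ - δf p‖ ^ 2) : ℝ) ∧
    |(cM * ‖δT‖ ^ 2 / T ^ 2 + ∫ p : R3, wgt T ‖p‖ * ‖δf p‖ ^ 2)⁻¹ *
          ∫ p : R3, wgt T ‖p‖ * ‖δf p‖ ^ 2 * (p 0 / ‖p‖)| ≤ 1 ∧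
    0 ≤ (cM * ‖δT‖ ^ 2 / T ^ 2 + ∫ p : R3, wgt T ‖p‖ * ‖δf p‖ ^ 2)⁻¹ *
          ∫ p : R3, wgt T ‖p‖ * (σA ‖p‖ * ‖δfBB T δT ‖p‖ - δf p‖ ^ 2 +
            σS ‖p‖ * ‖sphAvg δf ‖p‖ - δf p‖ ^ 2) := by
  have hwn (p : R3) : 0 ≤ wgt T ‖p‖ := wgt_nonneg hT (norm_nonneg p)
  have hPn (p : R3) : 0 ≤ wgt T ‖p‖ * ‖δf p‖ ^ 2 := mul_nonneg (hwn p) (sq_nonneg _)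
  have hle (p : R3) : ‖wgt T ‖p‖ * ‖δf p‖ ^ 2 * (p 0 / ‖p‖)‖ ≤ wgt T ‖p‖ * ‖δf p‖ ^ 2 := by
    rw [norm_mul, Real.norm_of_nonneg (hPn p)]
    exact mul_le_of_le_one_right (hPn p) (abs_coord_div_norm_le_one p 0)
  have hcoord : Measurable (fun p : R3 ↦ p 0 / ‖p‖) := by fun_prop
  have hQ : Integrable (fun p : R3 ↦ wgt T ‖p‖ * ‖δf p‖ ^ 2 * (p 0 / ‖p‖)) :=
    hInt1.mono' (hInt1.aestronglyMeasurable.mul hcoord.aestronglyMeasurable) (.of_forall hle)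
  have hB : (fun p : R3 ↦ wgt T ‖p‖ * (σA ‖p‖ * ‖δfBB T δT ‖p‖ - δf p‖ ^ 2 +
        σS ‖p‖ * ‖sphAvg δf ‖p‖ - δf p‖ ^ 2)) =
      fun p : R3 ↦ wgt T ‖p‖ * σA ‖p‖ * ‖δfBB T δT ‖p‖ - δf p‖ ^ 2 +
        wgt T ‖p‖ * σS ‖p‖ * ‖sphAvg δf ‖p‖ - δf p‖ ^ 2 := by
    funext p; ring
  have hBn : 0 ≤ ∫ p : R3, wgt T ‖p‖ * (σA ‖p‖ * ‖δfBB T δT ‖p‖ - δf p‖ ^ 2 +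
      σS ‖p‖ * ‖sphAvg δf ‖p‖ - δf p‖ ^ 2) := by
    refine integral_nonneg fun p ↦ ?_
    rcases eq_or_ne p 0 with rfl | hp
    · simp [wgt_zero]
    have hp : ‖p‖ ∈ Ioi (0 : ℝ) := norm_pos_iff.mpr hp
    have := hwn p
    have := hσA _ hp
    have := hσS _ hp
    positivity
  have hA : |∫ p : R3, wgt T ‖p‖ * ‖δf p‖ ^ 2 * (p 0 / ‖p‖)| ≤
      cM * ‖δT‖ ^ 2 / T ^ 2 + ∫ p : R3, wgt T ‖p‖ * ‖δf p‖ ^ 2 := by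
    have h1 := norm_integral_le_of_norm_le hInt1 (.of_forall hle)
    have h2 : 0 ≤ cM * ‖δT‖ ^ 2 / T ^ 2 := by positivity
    rw [Real.norm_eq_abs] at h1
    linarith
  set cross : R3 → ℂ := fun p ↦
    (wgt T ‖p‖ * σS ‖p‖ * conj (δfBB T δT ‖p‖ - sphAvg δf ‖p‖)) * (sphAvg δf ‖p‖ - δf p)
    with hcross
  have hcross0 : ∫ p, cross p = 0 :=
    integral_radial_mul_sphAvg_sub
      (fun q ↦ wgt T q * σS q * conj (δfBB T δT q - sphAvg δf q)) δf
  have hid : ∀ᵐ p : R3, cross p =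
      conj δT / (T : ℂ) ^ 2 * (((2 / (2 * Real.pi) ^ 3 * ‖p‖ : ℝ) : ℂ) * coll σA σS T δT δf p) +
      Complex.I * ω * ((wgt T ‖p‖ * ‖δf p‖ ^ 2 : ℝ) : ℂ) -
      Complex.I * k * ((wgt T ‖p‖ * ‖δf p‖ ^ 2 * (p 0 / ‖p‖) : ℝ) : ℂ) -
      ((wgt T ‖p‖ * σA ‖p‖ * ‖δfBB T δT ‖p‖ - δf p‖ ^ 2 +
        wgt T ‖p‖ * σS ‖p‖ * ‖sphAvg δf ‖p‖ - δf p‖ ^ 2 : ℝ) : ℂ) := by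
    filter_upwards [heq2] with p hp
    have h1 := collision_entropy_identity (w := wgt T ‖p‖) (sA := σA ‖p‖) (sS := σS ‖p‖)
      (F := δf p) (b := δfBB T δT ‖p‖) (a := sphAvg δf ‖p‖)
    change _ * coll σA σS T δT δf p = _ at h1
    have h2 := congrArg conj (wgt_mul_δfBB hT (norm_nonneg p) δT)
    simp only [map_mul, map_div₀, map_pow, Complex.conj_ofReal] at h2
    have h3 : (wgt T ‖p‖ : ℂ) * conj (δf p) * coll σA σS T δT δf p =
        -Complex.I * ω * ((wgt T ‖p‖ * ‖δf p‖ ^ 2 : ℝ) : ℂ) +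
        Complex.I * k * ((wgt T ‖p‖ * ‖δf p‖ ^ 2 * (p 0 / ‖p‖) : ℝ) : ℂ) := by
      rw [← hp, Complex.ofReal_mul (wgt T ‖p‖ * ‖δf p‖ ^ 2) (p 0 / ‖p‖),
        Complex.ofReal_mul (wgt T ‖p‖), Complex.ofReal_pow, ← Complex.conj_mul' (δf p)]
      ring
    rw [map_sub] at h1
    rw [Complex.ofReal_add]
    simp only [hcross]
    linear_combination -h1 - h3 + coll σA σS T δT δf p * h2
  have hE := hInt4.const_mul (conj δT / (T : ℂ) ^ 2)
  have hP' : Integrable (fun p : R3 ↦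
      Complex.I * ω * ((wgt T ‖p‖ * ‖δf p‖ ^ 2 : ℝ) : ℂ)) :=
    hInt1.ofReal.const_mul _
  have hQ' : Integrable (fun p : R3 ↦
      Complex.I * k * ((wgt T ‖p‖ * ‖δf p‖ ^ 2 * (p 0 / ‖p‖) : ℝ) : ℂ)) :=
    hQ.ofReal.const_mul _
  have hR' : Integrable (fun p : R3 ↦
      ((wgt T ‖p‖ * σA ‖p‖ * ‖δfBB T δT ‖p‖ - δf p‖ ^ 2 +
        wgt T ‖p‖ * σS ‖p‖ * ‖sphAvg δf ‖p‖ - δf p‖ ^ 2 : ℝ) : ℂ)) :=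
    (hInt2.add hInt3).ofReal
  have hEPQ : Integrable (fun p : R3 ↦
      conj δT / (T : ℂ) ^ 2 * (((2 / (2 * Real.pi) ^ 3 * ‖p‖ : ℝ) : ℂ) * coll σA σS T δT δf p) +
      Complex.I * ω * ((wgt T ‖p‖ * ‖δf p‖ ^ 2 : ℝ) : ℂ) -
      Complex.I * k * ((wgt T ‖p‖ * ‖δf p‖ ^ 2 * (p 0 / ‖p‖) : ℝ) : ℂ)) :=
    (hE.fun_add hP').sub hQ'
  have hmain := integral_congr_ae hid
  rw [hcross0, integral_sub hEPQ hR', integral_sub (hE.fun_add hP') hQ',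
    integral_add hE hP', integral_const_mul, integral_const_mul, integral_const_mul,
    integral_complex_ofReal, integral_complex_ofReal, integral_complex_ofReal, ← hB] at hmain
  set E := ∫ p : R3, ((2 / (2 * Real.pi) ^ 3 * ‖p‖ : ℝ) : ℂ) * coll σA σS T δT δf p
  set n := ∫ p : R3, wgt T ‖p‖ * ‖δf p‖ ^ 2
  set a := ∫ p : R3, wgt T ‖p‖ * ‖δf p‖ ^ 2 * (p 0 / ‖p‖)
  set b := ∫ p : R3, wgt T ‖p‖ * (σA ‖p‖ * ‖δfBB T δT ‖p‖ - δf p‖ ^ 2 +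
      σS ‖p‖ * ‖sphAvg δf ‖p‖ - δf p‖ ^ 2)
  set N := cM * ‖δT‖ ^ 2 / T ^ 2 + n with hNdef
  refine ⟨?_, ?_, mul_nonneg (inv_nonneg.mpr hN.le) hBn⟩
  · have hNc : (N : ℂ) = cM * (conj δT * δT) / (T : ℂ) ^ 2 + n := by
      rw [hNdef, Complex.conj_mul']
      push_cast
      ring
    have hN0 : (N : ℂ) ≠ 0 := Complex.ofReal_ne_zero.mpr hN.ne'
    have hωN : ω * N = k * a - Complex.I * b := by
      rw [hNc]
      linear_combination Complex.I * hmain + Complex.I * conj δT / (T : ℂ) ^ 2 * heq1 +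
        (ω * (cM * (conj δT * δT) / (T : ℂ) ^ 2 + n) - k * a) * Complex.I_sq
    push_cast
    field_simp
    linear_combination hωN
  · rw [abs_mul, abs_of_pos (inv_pos.mpr hN), inv_mul_le_iff₀ hN, mul_one]
    exact hA
end
end

section
/- Let a ∈ ℂ with Re a > 0 and let k ∈ ℝ∖{0}. Then the function r ↦ e^{−i k r¹} e^{−a|r|}/(4π|r|²) is absolutely integrable on ℝ³, and ∫_{ℝ³} e^{−i k r¹} e^{−a|r|}/(4π|r|²) d³r = arctan(k/a)/k, where arctan(z) := (1/(2i))·Log((1+iz)/(1−iz)) denotes the principal branch of the complex inverse tangent and r¹ is the first component of r ∈ ℝ³. -/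
/-!
Statement 5: the retarded radiative energy propagator in Fourier space:
for `Re a > 0` and real `k ≠ 0`, the function `r ↦ e^{−ikr¹} e^{−a|r|}/(4π|r|²)`
is absolutely integrable on ℝ³ and
`∫_{ℝ³} e^{−ikr¹} e^{−a|r|}/(4π|r|²) d³r = arctan(k/a)/k`,
with `arctan` the principal complex arctangent.
-/

noncomputable section
open MeasureTheory Real Set

/-- Splitting off the first coordinate of `ℝ³` preserves volume. -/
theorem exists_measurePreserving_axial :
    ∃ e : R3 ≃ᵐ ℝ × EuclideanSpace ℝ (Fin 2), MeasurePreserving e ∧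
      ∀ r, (e r).1 = r 0 ∧ √((e r).1 ^ 2 + ‖(e r).2‖ ^ 2) = ‖r‖ := by
  refine ⟨(MeasurableEquiv.toLp 2 (Fin 3 → ℝ)).symm.trans
    ((MeasurableEquiv.piFinSuccAbove (fun _ : Fin 3 => ℝ) 0).trans
      ((MeasurableEquiv.refl ℝ).prodCongr (MeasurableEquiv.toLp 2 (Fin 2 → ℝ)))), ?_, ?_⟩
  · exact (((MeasurePreserving.id volume).prod (PiLp.volume_preserving_toLp (Fin 2))).comp
      (volume_preserving_piFinSuccAbove (fun _ : Fin 3 => ℝ) 0)).comp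
      (PiLp.volume_preserving_ofLp (Fin 3))
  · intro r
    refine ⟨rfl, ?_⟩
    rw [EuclideanSpace.norm_eq r, EuclideanSpace.norm_sq_eq, Fin.sum_univ_succ]
    simp only [Real.norm_eq_abs, sq_abs]
    rfl

/-- Integrals over the plane of radial functions. -/
theorem integral_plane_fun_norm {F : Type*} [NormedAddCommGroup F] [NormedSpace ℝ F]
    (f : ℝ → F) :
    ∫ w : EuclideanSpace ℝ (Fin 2), f ‖w‖ = (2 * π) • ∫ s in Ioi (0 : ℝ), s • f s := by
  have hball : (volume : Measure (EuclideanSpace ℝ (Fin 2))).real (Metric.ball 0 1) = π := by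
    simp [Measure.real, EuclideanSpace.volume_ball_fin_two, pi_pos.le]
  rw [integral_fun_norm_addHaar volume f, hball, finrank_euclideanSpace_fin]
  simp only [Nat.add_one_sub_one, pow_one, ← Nat.cast_smul_eq_nsmul ℝ, smul_smul]
  norm_num

/-- An integrable function of the first coordinate and the distance to the origin, in cylindrical
coordinates. -/
theorem integrable_halfPlane_of_axial (f : ℝ → ℝ → ℂ) (hf : Measurable (Function.uncurry f))
    (hi : Integrable (fun r : R3 => f (r 0) ‖r‖)) :
    Integrable (fun q : ℝ × ℝ => q.2 • f q.1 √(q.1 ^ 2 + q.2 ^ 2))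
        (volume.prod (volume.restrict (Ioi 0))) ∧
      ∫ r : R3, f (r 0) ‖r‖ =
        (2 * π) • ∫ q : ℝ × ℝ, q.2 • f q.1 √(q.1 ^ 2 + q.2 ^ 2)
          ∂(volume.prod (volume.restrict (Ioi 0))) := by
  obtain ⟨e, he, her⟩ := exists_measurePreserving_axial
  have hfe : (fun r : R3 => f (r 0) ‖r‖) =
      (fun p : ℝ × EuclideanSpace ℝ (Fin 2) => f p.1 √(p.1 ^ 2 + ‖p.2‖ ^ 2)) ∘ e := by
    funext r
    simp only [Function.comp, (her r).2]
    rw [(her r).1]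
  have hi' : Integrable
      (fun p : ℝ × EuclideanSpace ℝ (Fin 2) => f p.1 √(p.1 ^ 2 + ‖p.2‖ ^ 2))
      (volume.prod volume) := by
    rw [hfe] at hi
    exact (he.integrable_comp_emb e.measurableEmbedding).1 hi
  have hmeas : Measurable (fun q : ℝ × ℝ => q.2 • f q.1 √(q.1 ^ 2 + q.2 ^ 2)) :=
    measurable_snd.smul (hf.comp (measurable_fst.prodMk
      ((measurable_fst.pow_const 2).add (measurable_snd.pow_const 2)).sqrt))
  have hint : Integrable (fun q : ℝ × ℝ => q.2 • f q.1 √(q.1 ^ 2 + q.2 ^ 2))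
        (volume.prod (volume.restrict (Ioi 0))) := by
    obtain ⟨h₁, h₂⟩ := (integrable_prod_iff hi'.aestronglyMeasurable).1 hi'
    refine (integrable_prod_iff hmeas.aestronglyMeasurable).2 ⟨?_, ?_⟩
    · filter_upwards [h₁] with x hx
      have := (integrable_fun_norm_addHaar (E := EuclideanSpace ℝ (Fin 2)) volume
        (f := fun s => f x √(x ^ 2 + s ^ 2))).1 hx
      simpa [IntegrableOn] using this
    · refine (h₂.const_mul (2 * π)⁻¹).congr (.of_forall fun x => ?_)
      simp only
      rw [integral_plane_fun_norm (fun s => ‖f x √(x ^ 2 + s ^ 2)‖), smul_eq_mul,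
        inv_mul_cancel_left₀ two_pi_pos.ne']
      refine setIntegral_congr_fun measurableSet_Ioi fun s hs => ?_
      simp only [norm_smul, Real.norm_of_nonneg (le_of_lt (mem_Ioi.1 hs)), smul_eq_mul]
  refine ⟨hint, ?_⟩
  rw [integral_prod _ hint, hfe]
  simp only [Function.comp_def]
  rw [he.integral_comp e.measurableEmbedding
    (fun p : ℝ × EuclideanSpace ℝ (Fin 2) => f p.1 √(p.1 ^ 2 + ‖p.2‖ ^ 2)),
    Measure.volume_eq_prod, integral_prod _ hi', ← integral_smul]
  congr 1 with x
  exact integral_plane_fun_norm (fun s => f x √(x ^ 2 + s ^ 2))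

/-- An integrable function of the first coordinate and the distance to the origin, in spherical
coordinates. -/
theorem integral_axial_eq_spherical (f : ℝ → ℝ → ℂ) (hf : Measurable (Function.uncurry f))
    (hi : Integrable (fun r : R3 => f (r 0) ‖r‖)) :
    ∫ r : R3, f (r 0) ‖r‖ =
      (2 * π) • ∫ p in Ioi (0 : ℝ) ×ˢ Ioo 0 π,
        (p.1 ^ 2 * sin p.2) • f (p.1 * cos p.2) p.1 := by
  rw [(integrable_halfPlane_of_axial f hf hi).2]
  congr 1
  have hprod : (volume : Measure ℝ).prod (volume.restrict (Ioi 0)) =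
      (volume : Measure (ℝ × ℝ)).restrict (univ ×ˢ Ioi 0) := by
    rw [Measure.volume_eq_prod, ← Measure.prod_restrict, Measure.restrict_univ]
  have hms : MeasurableSet ((univ : Set ℝ) ×ˢ Ioi (0 : ℝ)) :=
    MeasurableSet.univ.prod measurableSet_Ioi
  have hmt : MeasurableSet (Ioi (0 : ℝ) ×ˢ Ioo 0 π) := measurableSet_Ioi.prod measurableSet_Ioo
  rw [hprod, ← integral_indicator hms, ← integral_comp_polarCoord_symm,
    ← integral_indicator hmt,
    ← integral_indicator polarCoord.open_target.measurableSet]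
  congr 1 with p
  obtain ⟨ρ, θ⟩ := p
  by_cases hρ : 0 < ρ
  swap
  · simp [indicator, hρ]
  by_cases hθ : θ ∈ Ioo (-π) π
  swap
  · have : θ ∉ Ioo 0 π := fun h => hθ ⟨by linarith [h.1, pi_pos], h.2⟩
    rw [indicator_of_notMem (by simpa [hρ] using hθ),
      indicator_of_notMem (by simpa [hρ] using this)]
  rw [indicator_of_mem (by simpa [hρ] using hθ)]
  by_cases hθ' : 0 < θ
  · have hs := sin_pos_of_pos_of_lt_pi hθ' hθ.2
    have hn : √((ρ * cos θ) ^ 2 + (ρ * sin θ) ^ 2) = ρ := by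
      rw [mul_pow, mul_pow, ← mul_add, cos_sq_add_sin_sq, mul_one, sqrt_sq hρ.le]
    simp only [polarCoord_symm_apply]
    rw [indicator_of_mem (by simp [mul_pos hρ hs]), indicator_of_mem (by simp [hρ, hθ', hθ.2])]
    simp only [hn, smul_smul]
    ring_nf
  · have hs : sin θ ≤ 0 := sin_nonpos_of_nonpos_of_neg_pi_le (not_lt.1 hθ') hθ.1.le
    simp only [polarCoord_symm_apply]
    rw [indicator_of_notMem (by simpa using mul_nonpos_of_nonneg_of_nonpos hρ.le hs),
      indicator_of_notMem (by simp [hθ']), smul_zero]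

/-- The angular integral of the propagator. -/
theorem integral_sin_div_add_mul_cos {a : ℂ} (ha : 0 < a.re) {k : ℝ} (hk : k ≠ 0) :
    ∫ θ in (0 : ℝ)..π, (sin θ : ℂ) / (a + Complex.I * k * cos θ) =
      2 * (Complex.arctan (k / a) / k) := by
  have hre (t : ℝ) : 0 < (a + Complex.I * k * t).re := by simpa using ha
  have hne (t : ℝ) : a + Complex.I * k * t ≠ 0 := fun h => by simpa [h] using hre t
  have hk' : (k : ℂ) ≠ 0 := by exact_mod_cast hk
  have ha0 : a ≠ 0 := fun h => by simp [h] at ha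
  have hderiv : ∀ θ ∈ uIcc (0 : ℝ) π, HasDerivAt
      (fun θ : ℝ => Complex.I / k * Complex.log (a + Complex.I * k * cos θ))
      ((sin θ : ℂ) / (a + Complex.I * k * cos θ)) θ := by
    intro θ _
    have h := ((((hasDerivAt_cos θ).ofReal_comp).const_mul (Complex.I * k)).const_add a).clog_real
      (Or.inl (hre _))
    refine (h.const_mul (Complex.I / k)).congr_deriv ?_
    rw [← mul_div_assoc]
    congr 1
    push_cast
    field_simp
    simp
  rw [intervalIntegral.integral_eq_sub_of_hasDerivAt hderiv]
  · have hquot : (1 + k / a * Complex.I) / (1 - k / a * Complex.I) =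
        (a + Complex.I * k * (1 : ℝ)) * (a + Complex.I * k * (-1 : ℝ))⁻¹ := by
      have h₁ := hne (-1)
      have h₂ : 1 - k / a * Complex.I ≠ 0 := by
        intro h
        apply h₁
        have : a * (1 - k / a * Complex.I) = 0 := by rw [h, mul_zero]
        field_simp at this
        push_cast
        linear_combination this
      rw [← div_eq_mul_inv, div_eq_div_iff h₂ h₁]
      field_simp
      push_cast
      ring
    have harg (t : ℝ) := abs_lt.1 (Complex.abs_arg_lt_pi_div_two_iff.2 (Or.inl (hre t)))
    have hpi : (a + Complex.I * k * (-1 : ℝ)).arg ≠ π := by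
      linarith [(harg (-1)).2, pi_pos]
    have h₁ := harg 1
    have h₂ := harg (-1)
    rw [Complex.arctan, hquot, Complex.log_mul (hne _) (inv_ne_zero (hne _)), Complex.log_inv _ hpi,
      cos_pi, cos_zero]
    · field_simp
      ring
    · rw [Complex.arg_inv, if_neg hpi]
      constructor <;> linarith [h₁.1, h₁.2, h₂.1, h₂.2]
  · apply Continuous.intervalIntegrable
    exact Continuous.div (by fun_prop) (by fun_prop) fun θ => hne _

/-- The propagator is absolutely integrable. -/
theorem integrable_propagator {a : ℂ} (ha : 0 < a.re) (k : ℝ) :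
    Integrable (fun r : R3 =>
      Complex.exp (-(Complex.I * k * (r 0 : ℝ))) * Complex.exp (-(a * ‖r‖)) /
        (4 * Real.pi * ‖r‖ ^ 2)) := by
  have h : Integrable (fun r : R3 => rexp (-a.re * ‖r‖) / (4 * π * ‖r‖ ^ 2)) := by
    rw [integrable_fun_norm_addHaar volume (f := fun s => rexp (-a.re * s) / (4 * π * s ^ 2)),
      finrank_euclideanSpace_fin]
    refine IntegrableOn.congr_fun ((exp_neg_integrableOn_Ioi 0 ha).const_mul (4 * π)⁻¹)
      (fun s hs => ?_) measurableSet_Ioi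
    have : s ≠ 0 := (mem_Ioi.1 hs).ne'
    simp only [Nat.add_one_sub_one, smul_eq_mul]
    field_simp
  refine h.mono' (Measurable.aestronglyMeasurable (by fun_prop)) (.of_forall fun r => le_of_eq ?_)
  simp [Complex.norm_exp, abs_of_pos pi_pos]

/-- The propagator is jointly integrable in the radial and angular variables. -/
theorem integrable_sin_mul_exp {a : ℂ} (ha : 0 < a.re) (k : ℝ) :
    IntegrableOn (fun p : ℝ × ℝ =>
      (sin p.1 : ℂ) * Complex.exp (-(a + Complex.I * k * cos p.1) * p.2)) (Ioo 0 π ×ˢ Ioi 0) := by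
  rw [IntegrableOn, Measure.volume_eq_prod, ← Measure.prod_restrict]
  have h₁ : Integrable (fun _ : ℝ => (1 : ℝ)) (volume.restrict (Ioo 0 π)) := by simp
  refine (h₁.mul_prod (exp_neg_integrableOn_Ioi 0 ha)).mono'
    (Continuous.aestronglyMeasurable (by fun_prop)) (.of_forall fun p => ?_)
  simp only [norm_mul, Complex.norm_exp, Complex.norm_real, Real.norm_eq_abs]
  refine mul_le_mul (abs_sin_le_one _) (le_of_eq ?_) (exp_pos _).le zero_le_one
  simp

theorem retarded_propagator_fourier
    (a : ℂ) (ha : 0 < a.re) (k : ℝ) (hk : k ≠ 0) :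
    Integrable (fun r : R3 =>
      Complex.exp (-(Complex.I * k * (r 0 : ℝ))) * Complex.exp (-(a * ‖r‖)) /
        (4 * Real.pi * ‖r‖ ^ 2)) ∧
    (∫ r : R3, Complex.exp (-(Complex.I * k * (r 0 : ℝ))) * Complex.exp (-(a * ‖r‖)) /
        (4 * Real.pi * ‖r‖ ^ 2)) = Complex.arctan (k / a) / k := by
  have hi := integrable_propagator ha k
  refine ⟨hi, ?_⟩
  rw [integral_axial_eq_spherical (fun x s => Complex.exp (-(Complex.I * k * x)) *
    Complex.exp (-(a * s)) / (4 * Real.pi * s ^ 2)) (by unfold Function.uncurry; fun_prop) hi]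
  have hcongr : ∫ p in Ioi (0 : ℝ) ×ˢ Ioo 0 π, (p.1 ^ 2 * sin p.2) •
        (Complex.exp (-(Complex.I * k * (p.1 * cos p.2 : ℝ))) * Complex.exp (-(a * p.1)) /
          (4 * Real.pi * p.1 ^ 2)) =
      ∫ p in Ioi (0 : ℝ) ×ˢ Ioo 0 π, (4 * π : ℂ)⁻¹ * ((sin p.swap.1 : ℂ) *
        Complex.exp (-(a + Complex.I * k * cos p.swap.1) * p.swap.2)) := by
    refine setIntegral_congr_fun (measurableSet_Ioi.prod measurableSet_Ioo) fun p hp => ?_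
    have hp0 : (p.1 : ℂ) ≠ 0 := by exact_mod_cast (mem_Ioi.1 hp.1).ne'
    have hpi : (π : ℂ) ≠ 0 := by exact_mod_cast pi_ne_zero
    have hexp : Complex.exp (-(a + Complex.I * k * cos p.2) * p.1) =
        Complex.exp (-(Complex.I * k * (p.1 * cos p.2 : ℝ))) * Complex.exp (-(a * p.1)) := by
      rw [← Complex.exp_add]
      congr 1
      push_cast
      ring
    simp only [Prod.fst_swap, Prod.snd_swap, hexp, Complex.real_smul]
    push_cast
    field_simp
  have hradial (θ : ℝ) : ∫ ρ in Ioi (0 : ℝ),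
      (sin θ : ℂ) * Complex.exp (-(a + Complex.I * k * cos θ) * ρ) =
        (sin θ : ℂ) / (a + Complex.I * k * cos θ) := by
    rw [integral_const_mul, integral_exp_mul_complex_Ioi (by simpa using ha)]
    rw [Complex.ofReal_zero, mul_zero, Complex.exp_zero, neg_div_neg_eq, mul_one_div]
  have hpi : (π : ℂ) ≠ 0 := by exact_mod_cast pi_ne_zero
  rw [hcongr, integral_const_mul, Measure.volume_eq_prod,
    setIntegral_prod_swap (Ioo 0 π) (Ioi 0) (fun p : ℝ × ℝ => (sin p.1 : ℂ) *
      Complex.exp (-(a + Complex.I * k * cos p.1) * p.2)),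
    setIntegral_prod _ (integrable_sin_mul_exp ha k)]
  simp only [hradial]
  rw [← integral_Ioc_eq_integral_Ioo, ← intervalIntegral.integral_of_le pi_pos.le,
    integral_sin_div_add_mul_cos ha hk, Complex.real_smul]
  push_cast
  field_simp
  norm_num
end
end

section
/- Grey medium with scattering: let T > 0, c_M > 0, τ > 0, ϖ ∈ [0,1], and take constant coefficients σ_A ≡ (1−ϖ)/τ and σ_S ≡ ϖ/τ. Let k ∈ ℝ∖{0}, ω ∈ ℂ with Im(ωτ) < 1, δT ∈ ℂ∖{0}, and let δf : ℝ³∖{0} → ℂ be measurable such that the plane-wave radiative transfer system (i)–(ii) holds with all stated integrals finite, and assume 1 − (ϖ/(kτ))·arctan(kτ/(1−iωτ)) ≠ 0. Then ω = −i (λ/τ)(1−ϖ) · [1 − (1/(kτ))·arctan(kτ/(1−iωτ))] / [1 − (ϖ/(kτ))·arctan(kτ/(1−iωτ))], where λ = c_R/c_M with c_R = 4π²T³/15, and arctan is the principal complex inverse tangent arctan(z) = (1/(2i))Log((1+iz)/(1−iz)). -/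
/-! Statement 6: the exact dispersion relation of radiative transfer in a grey
medium with isotropic scattering (relativistic generalization of Spiegel's formula):
ω = −i(λ/τ)(1−ϖ)[1 − arctan(kτ/(1−iωτ))/(kτ)]/[1 − (ϖ/(kτ))arctan(kτ/(1−iωτ))]. -/

noncomputable section
open MeasureTheory Real Set

/-- Spherical coordinates `(Ω, r) ↦ r Ω` on momentum space. -/
def polarMap (x : Metric.sphere (0 : R3) 1 × Ioi (0 : ℝ)) : R3 := (x.2 : ℝ) • (x.1 : R3)

theorem polarMap_eq :
    polarMap = Subtype.val ∘ (homeomorphUnitSphereProd R3).symm := by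
  ext1 x
  simp [polarMap]

theorem measurableEmbedding_polarMap : MeasurableEmbedding polarMap := by
  rw [polarMap_eq]
  exact (MeasurableEmbedding.subtype_coe (measurableSet_singleton _).compl).comp
    (Homeomorph.measurableEmbedding _)

theorem measurePreserving_polarMap :
    MeasurePreserving polarMap
      ((volume : Measure R3).toSphere.prod (Measure.volumeIoiPow 2)) volume := by
  have h1 := (volume : Measure R3).measurePreserving_homeomorphUnitSphereProd
  have hd : Module.finrank ℝ R3 - 1 = 2 := by simp
  rw [hd] at h1
  have h2 := MeasurePreserving.symm (homeomorphUnitSphereProd R3).toMeasurableEquiv h1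
  have h3 : MeasurePreserving (Subtype.val : ({0}ᶜ : Set R3) → R3)
      ((volume : Measure R3).comap Subtype.val) volume := by
    refine ⟨measurable_subtype_coe, ?_⟩
    rw [map_comap_subtype_coe (measurableSet_singleton _).compl, restrict_compl_singleton]
  rw [polarMap_eq]
  exact h3.comp h2

theorem ae_polar {P : R3 → Prop} (h : ∀ᵐ p : R3, P p) :
    ∀ᵐ r : Ioi (0 : ℝ) ∂Measure.volumeIoiPow 2,
      ∀ᵐ Ω : Metric.sphere (0 : R3) 1 ∂(volume : Measure R3).toSphere, P ((r : ℝ) • (Ω : R3)) := by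
  have h1 := measurePreserving_polarMap.quasiMeasurePreserving.ae h
  have h2 := Measure.measurePreserving_swap.quasiMeasurePreserving.ae h1
  exact Measure.ae_ae_of_ae_prod h2

theorem integrable_polar {E : Type*} [NormedAddCommGroup E] {f : R3 → E} (h : Integrable f) :
    ∀ᵐ r : Ioi (0 : ℝ) ∂Measure.volumeIoiPow 2,
      Integrable (fun Ω : Metric.sphere (0 : R3) 1 => f ((r : ℝ) • (Ω : R3)))
        (volume : Measure R3).toSphere :=
  ((measurePreserving_polarMap.integrable_comp_emb measurableEmbedding_polarMap).2 h).prod_left_ae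

theorem integral_polar {E : Type*} [NormedAddCommGroup E] [NormedSpace ℝ E] {f : R3 → E}
    (h : Integrable f) :
    ∫ p, f p = ∫ r : Ioi (0 : ℝ), (∫ Ω : Metric.sphere (0 : R3) 1, f ((r : ℝ) • (Ω : R3))
      ∂(volume : Measure R3).toSphere) ∂Measure.volumeIoiPow 2 := by
  rw [← measurePreserving_polarMap.integral_comp measurableEmbedding_polarMap]
  exact integral_prod_symm _
    ((measurePreserving_polarMap.integrable_comp_emb measurableEmbedding_polarMap).2 h)

theorem integral_volumeIoiPow {E : Type*} [NormedAddCommGroup E] [NormedSpace ℝ E] (n : ℕ)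
    (f : ℝ → E) :
    ∫ r : Ioi (0 : ℝ), f r ∂Measure.volumeIoiPow n = ∫ r in Ioi (0 : ℝ), r ^ n • f r := by
  simp only [Measure.volumeIoiPow, ENNReal.ofReal]
  rw [integral_withDensity_eq_integral_smul,
    integral_subtype_comap measurableSet_Ioi fun a ↦ Real.toNNReal (a ^ n) • f a]
  · refine setIntegral_congr_fun measurableSet_Ioi fun x hx ↦ ?_
    simp only [NNReal.smul_def, Real.coe_toNNReal _ (pow_nonneg (le_of_lt hx) _)]
  · exact (measurable_subtype_coe.pow_const _).real_toNNReal

theorem integral_pow_mul_exp_neg_sq (n : ℕ) :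
    ∫ r in Ioi (0 : ℝ), r ^ n * Real.exp (-r ^ 2) = Real.Gamma ((n + 1) / 2) / 2 := by
  have h := integral_rpow_mul_exp_neg_rpow (p := 2) (q := n) (by norm_num)
    (by have := n.cast_nonneg (α := ℝ); linarith)
  simp only [Real.rpow_natCast, Real.rpow_two] at h
  rw [h]; ring

theorem integral_coord_pow_mul_gaussian (n : ℕ) :
    ∫ p : R3, p 0 ^ n * Real.exp (-‖p‖ ^ 2) = (∫ x : ℝ, x ^ n * Real.exp (-x ^ 2)) * π := by
  rw [← (PiLp.volume_preserving_toLp (Fin 3)).integral_comp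
    (MeasurableEquiv.toLp 2 (Fin 3 → ℝ)).measurableEmbedding]
  have hfac : ∀ x : Fin 3 → ℝ, (WithLp.toLp 2 x : R3) 0 ^ n * Real.exp (-‖(WithLp.toLp 2 x : R3)‖ ^ 2)
      = ∏ i, (![fun y : ℝ => y ^ n * Real.exp (-y ^ 2), fun y => Real.exp (-1 * y ^ 2),
        fun y => Real.exp (-1 * y ^ 2)] i) (x i) := by
    intro x
    simp only [EuclideanSpace.norm_sq_eq, Fin.prod_univ_three, Fin.sum_univ_three]
    simp only [Real.norm_eq_abs, sq_abs, neg_add, Real.exp_add, Matrix.cons_val, neg_one_mul]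
    ring
  simp_rw [hfac]
  rw [integral_fintype_prod_volume_eq_prod, Fin.prod_univ_three]
  simp only [Matrix.cons_val, integral_gaussian, div_one]
  rw [mul_assoc, Real.mul_self_sqrt Real.pi_pos.le]

theorem sphere_moment_mul (n : ℕ) :
    (∫ Ω : Metric.sphere (0 : R3) 1, (Ω : R3) 0 ^ n ∂(volume : Measure R3).toSphere) *
      (Real.Gamma ((n + 3) / 2) / 2) = (∫ x : ℝ, x ^ n * Real.exp (-x ^ 2)) * π := by
  rw [← integral_coord_pow_mul_gaussian,
    ← measurePreserving_polarMap.integral_comp measurableEmbedding_polarMap]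
  have hr : ∫ r : Ioi (0 : ℝ), (r : ℝ) ^ n * Real.exp (-(r : ℝ) ^ 2) ∂Measure.volumeIoiPow 2 =
      Real.Gamma ((n + 3) / 2) / 2 := by
    rw [integral_volumeIoiPow 2 (fun r => r ^ n * Real.exp (-r ^ 2))]
    have := integral_pow_mul_exp_neg_sq (n + 2)
    push_cast at this
    rw [show ((n : ℝ) + 3) = n + 2 + 1 by ring, ← this]
    congr 1; ext r; rw [smul_eq_mul]; ring
  rw [← hr, ← integral_prod_mul]
  congr 1
  ext ⟨Ω, r⟩
  have hn : ‖(r : ℝ) • (Ω : R3)‖ = r := by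
    rw [norm_smul, norm_eq_of_mem_sphere, mul_one, Real.norm_of_nonneg r.2.out.le]
  simp only [polarMap, hn, PiLp.smul_apply, smul_eq_mul, mul_pow]
  ring

theorem sphere_moment (n : ℕ) :
    ∫ Ω : Metric.sphere (0 : R3) 1, (Ω : R3) 0 ^ n ∂(volume : Measure R3).toSphere =
      2 * π * ∫ x in (-1 : ℝ)..1, x ^ n := by
  have hG : Real.Gamma (((n : ℝ) + 3) / 2) = (n + 1) / 2 * Real.Gamma ((n + 1) / 2) := by
    rw [← Real.Gamma_add_one (by positivity)]
    congr 1; ring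
  have hpos : 0 < Real.Gamma (((n : ℝ) + 1) / 2) := Real.Gamma_pos_of_pos (by positivity)
  have h := sphere_moment_mul n
  rw [integral_pow]
  rcases n.even_or_odd with hn | hn
  · have habs : ∫ x : ℝ, x ^ n * Real.exp (-x ^ 2) = Real.Gamma ((n + 1) / 2) := by
      have := integral_comp_abs (f := fun x : ℝ => x ^ n * Real.exp (-x ^ 2))
      simp only [hn.pow_abs, sq_abs] at this
      rw [this, integral_pow_mul_exp_neg_sq]; ring
    rw [habs, hG] at h
    rw [hn.add_one.neg_one_pow]
    have hn1 : (n : ℝ) + 1 ≠ 0 := by positivity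
    refine mul_right_cancel₀ hpos.ne' ?_
    field_simp at h ⊢
    linear_combination h
  · have hzero : ∫ x : ℝ, x ^ n * Real.exp (-x ^ 2) = 0 := by
      have := integral_neg_eq_self (fun x : ℝ => x ^ n * Real.exp (-x ^ 2)) volume
      simp only [hn.neg_pow, neg_sq, neg_mul, integral_neg] at this
      linarith
    rw [hzero, zero_mul, hG] at h
    rw [hn.add_one.neg_one_pow]
    have : (((n : ℝ) + 1) / 2 * Real.Gamma ((n + 1) / 2)) / 2 ≠ 0 := by positivity
    simpa [this] using h

theorem sphere_coord_mem_Icc (Ω : Metric.sphere (0 : R3) 1) : (Ω : R3) 0 ∈ Icc (-1 : ℝ) 1 := by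
  have h := PiLp.norm_apply_le (Ω : R3) 0
  rw [norm_eq_of_mem_sphere, Real.norm_eq_abs] at h
  exact abs_le.1 h

theorem map_coord_toSphere :
    (volume : Measure R3).toSphere.map (fun Ω : Metric.sphere (0 : R3) 1 => (Ω : R3) 0) =
      ENNReal.ofReal (2 * π) • volume.restrict (Icc (-1 : ℝ) 1) := by
  have hcont : Continuous (fun Ω : Metric.sphere (0 : R3) 1 => (Ω : R3) 0) := by fun_prop
  have : IsFiniteMeasure (ENNReal.ofReal (2 * π) • volume.restrict (Icc (-1 : ℝ) 1)) :=
    Measure.smul_finite _ ENNReal.ofReal_ne_top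
  set L : (ℝ → ℝ) → ℝ := fun f =>
    (∫ Ω : Metric.sphere (0 : R3) 1, f ((Ω : R3) 0) ∂(volume : Measure R3).toSphere) -
      2 * π * ∫ x in Icc (-1 : ℝ) 1, f x with hL
  have hI1 : ∀ f : ℝ → ℝ, Continuous f →
      Integrable (fun Ω : Metric.sphere (0 : R3) 1 => f ((Ω : R3) 0))
        (volume : Measure R3).toSphere := fun f hf =>
    (hf.comp hcont).integrable_of_hasCompactSupport (HasCompactSupport.of_compactSpace _)
  have hI2 : ∀ f : ℝ → ℝ, Continuous f → IntegrableOn f (Icc (-1 : ℝ) 1) := fun f hf =>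
    hf.integrableOn_Icc
  have hpoly : ∀ p : Polynomial ℝ, L (fun x => p.eval x) = 0 := fun p => by
    have hmon : ∀ n : ℕ, L (fun x => x ^ n) = 0 := fun n => by
      simp only [hL]
      rw [sphere_moment, integral_Icc_eq_integral_Ioc,
        intervalIntegral.integral_of_le (by norm_num), sub_self]
    simp only [hL, Polynomial.eval_eq_sum_range]
    rw [integral_finsetSum _ fun i _ => hI1 (fun x => p.coeff i * x ^ i) (by fun_prop),
      integral_finsetSum _ fun i _ => hI2 (fun x => p.coeff i * x ^ i) (by fun_prop),
      Finset.mul_sum, ← Finset.sum_sub_distrib]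
    refine Finset.sum_eq_zero fun i _ => ?_
    have := hmon i
    simp only [hL] at this
    simp only [integral_const_mul]
    linear_combination p.coeff i * this
  set M : ℝ := (volume : Measure R3).toSphere.real univ + 4 * π with hM
  have hM0 : 0 < M := by positivity
  have hbound : ∀ f : ℝ → ℝ, Continuous f → ∀ ε, (∀ x ∈ Icc (-1 : ℝ) 1, |f x| ≤ ε) →
      |L f| ≤ ε * M := fun f hf ε hε => by
    have h1 := norm_integral_le_of_norm_le_const (μ := (volume : Measure R3).toSphere)
      (f := fun Ω : Metric.sphere (0 : R3) 1 => f ((Ω : R3) 0)) (Filter.Eventually.of_forall fun Ω => hε _ (sphere_coord_mem_Icc Ω))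
    have h2 := norm_setIntegral_le_of_norm_le_const (μ := (volume : Measure ℝ))
      (s := Icc (-1 : ℝ) 1) (f := f) (by simp) hε
    simp only [Real.norm_eq_abs, Real.volume_real_Icc] at h1 h2
    have h3 : max ((1 : ℝ) - -1) 0 = 2 := by norm_num
    rw [h3] at h2
    calc |L f| ≤ _ := abs_sub _ _
      _ ≤ ε * (volume : Measure R3).toSphere.real univ + 2 * π * (ε * 2) := by
        rw [abs_mul, abs_of_pos Real.two_pi_pos]
        gcongr
      _ = ε * M := by rw [hM]; ring
  have hLzero : ∀ f : ℝ → ℝ, Continuous f → L f = 0 := fun f hf => by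
    refine abs_nonpos_iff.1 (le_of_forall_pos_le_add fun ε hε => ?_)
    obtain ⟨p, hp⟩ := exists_polynomial_near_of_continuousOn (-1) 1 f hf.continuousOn (ε / M)
      (by positivity)
    have h := hbound (fun x => p.eval x - f x) (p.continuous.sub hf) (ε / M)
      fun x hx => (hp x hx).le
    have hsub : L (fun x => p.eval x - f x) = L (fun x => p.eval x) - L f := by
      simp only [hL]
      rw [integral_sub (hI1 _ p.continuous) (hI1 _ hf),
        integral_sub (hI2 _ p.continuous) (hI2 _ hf)]
      ring
    rw [hsub, hpoly, zero_sub, abs_neg, div_mul_cancel₀ _ hM0.ne'] at h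
    simpa using h
  refine ext_of_forall_integral_eq_of_IsFiniteMeasure fun f => ?_
  rw [integral_map hcont.aemeasurable f.continuous.aestronglyMeasurable, integral_smul_measure,
    ENNReal.toReal_ofReal Real.two_pi_pos.le, smul_eq_mul]
  exact sub_eq_zero.1 (hLzero f f.continuous)

theorem integral_sphere_coord {E : Type*} [NormedAddCommGroup E] [NormedSpace ℝ E] {h : ℝ → E}
    (hh : StronglyMeasurable h) :
    ∫ Ω : Metric.sphere (0 : R3) 1, h ((Ω : R3) 0) ∂(volume : Measure R3).toSphere =
      (2 * π) • ∫ x in (-1 : ℝ)..1, h x := by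
  have hcont : Continuous (fun Ω : Metric.sphere (0 : R3) 1 => (Ω : R3) 0) := by fun_prop
  rw [← integral_map hcont.aemeasurable hh.aestronglyMeasurable, map_coord_toSphere,
    integral_smul_measure, ENNReal.toReal_ofReal Real.two_pi_pos.le,
    integral_Icc_eq_integral_Ioc, intervalIntegral.integral_of_le (by norm_num)]

theorem intervalIntegrable_of_integrable_sphere_coord {E : Type*} [NormedAddCommGroup E]
    {h : ℝ → E} (hh : StronglyMeasurable h)
    (hi : Integrable (fun Ω : Metric.sphere (0 : R3) 1 => h ((Ω : R3) 0))
      (volume : Measure R3).toSphere) :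
    IntervalIntegrable h volume (-1) 1 := by
  have hcont : Continuous (fun Ω : Metric.sphere (0 : R3) 1 => (Ω : R3) 0) := by fun_prop
  have h1 := (integrable_map_measure hh.aestronglyMeasurable hcont.aemeasurable).2 hi
  rw [map_coord_toSphere, integrable_smul_measure
    (ENNReal.ofReal_pos.2 Real.two_pi_pos).ne' ENNReal.ofReal_ne_top] at h1
  rw [intervalIntegrable_iff_integrableOn_Icc_of_le (by norm_num)]
  exact h1

theorem fBB_mul_one_add {T q : ℝ} (hq : q ≠ 0) (hT : T ≠ 0) :
    fBB T q * (1 + fBB T q) = Real.exp (-(q / T)) / (1 - Real.exp (-(q / T))) ^ 2 := by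
  have h : Real.exp (q / T) - 1 ≠ 0 := by
    rw [sub_ne_zero, Ne, Real.exp_eq_one_iff]
    exact div_ne_zero hq hT
  have h3 := Real.exp_ne_zero (q / T)
  have h2 : 1 - (Real.exp (q / T))⁻¹ = (Real.exp (q / T) - 1) / Real.exp (q / T) := by
    field_simp
  rw [fBB, Real.exp_neg, h2]
  field_simp
  ring

theorem fBB_mul_one_add_pos {T q : ℝ} (hq : 0 < q) (hT : 0 < T) :
    0 < fBB T q * (1 + fBB T q) := by
  have h : 0 < Real.exp (q / T) - 1 := sub_pos.2 (Real.one_lt_exp_iff.2 (div_pos hq hT))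
  have : 0 < fBB T q := one_div_pos.2 h
  positivity

theorem integral_pow_four_mul_exp_neg {b : ℝ} (hb : 0 < b) :
    ∫ q in Ioi (0 : ℝ), q ^ 4 * Real.exp (-(b * q)) = 24 / b ^ 5 := by
  have h := Real.integral_rpow_mul_exp_neg_mul_Ioi (a := 5) (by norm_num) hb
  have hG : Real.Gamma 5 = 24 := by
    rw [show (5 : ℝ) = (4 : ℕ) + 1 by norm_num, Real.Gamma_nat_eq_factorial]
    norm_num [Nat.factorial]
  rw [hG, show (5 : ℝ) - 1 = (4 : ℕ) by norm_num, show (5 : ℝ) = (5 : ℕ) by norm_num] at h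
  simp only [Real.rpow_natCast] at h
  rw [h]
  field_simp

theorem integrableOn_pow_four_mul_exp_neg {b : ℝ} (hb : 0 < b) :
    IntegrableOn (fun q : ℝ => q ^ 4 * Real.exp (-(b * q))) (Ioi 0) := by
  refine Integrable.of_integral_ne_zero ?_
  rw [integral_pow_four_mul_exp_neg hb]
  positivity

/-- The fourth moment of `f_BB (1 + f_BB)`, which gives the specific heat of radiation. -/
theorem integral_pow_four_mul_fBB {T : ℝ} (hT : 0 < T) :
    ∫ q in Ioi (0 : ℝ), q ^ 4 * (fBB T q * (1 + fBB T q)) = 4 * π ^ 4 / 15 * T ^ 5 := by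
  set F : ℕ → ℝ → ℝ := fun n q => n * (q ^ 4 * Real.exp (-(n / T * q))) with hF
  have hfin : ∀ n, IntegrableOn (F n) (Ioi 0) := fun n => by
    rcases n.eq_zero_or_pos with rfl | hn
    · simp [hF]
    · exact (integrableOn_pow_four_mul_exp_neg (by positivity)).const_mul _
  have hval : ∀ n, ∫ q in Ioi (0 : ℝ), F n q = 24 * T ^ 5 * (1 / (n : ℝ) ^ 4) := fun n => by
    rcases n.eq_zero_or_pos with rfl | hn
    · simp [hF]
    · simp only [hF]
      rw [integral_const_mul, integral_pow_four_mul_exp_neg (by positivity)]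
      field_simp
  have hnorm : ∀ n, ∫ q in Ioi (0 : ℝ), ‖F n q‖ = ∫ q in Ioi (0 : ℝ), F n q := fun n => by
    refine setIntegral_congr_fun measurableSet_Ioi fun q _ => ?_
    exact Real.norm_of_nonneg (by simp only [hF]; positivity)
  have hsum : HasSum (fun n : ℕ => 24 * T ^ 5 * (1 / (n : ℝ) ^ 4)) (24 * T ^ 5 * (π ^ 4 / 90)) :=
    hasSum_zeta_four.mul_left _
  have key := hasSum_integral_of_summable_integral_norm hfin
    (by simp only [hnorm, hval]; exact hsum.summable)
  simp only [hval] at key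
  have h := key.unique hsum
  rw [show 4 * π ^ 4 / 15 * T ^ 5 = 24 * T ^ 5 * (π ^ 4 / 90) by ring, ← h]
  refine setIntegral_congr_fun measurableSet_Ioi fun q (hq : 0 < q) => ?_
  have hlt : ‖Real.exp (-(q / T))‖ < 1 := by
    rw [Real.norm_of_nonneg (Real.exp_pos _).le, Real.exp_lt_one_iff]
    exact neg_lt_zero.2 (div_pos hq hT)
  have hg := (hasSum_coe_mul_geometric_of_norm_lt_one hlt).mul_left (q ^ 4)
  rw [fBB_mul_one_add hq.ne' hT.ne', ← hg.tsum_eq]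
  refine tsum_congr fun n => ?_
  simp only [hF]
  rw [← Real.exp_nat_mul, show (n : ℝ) * -(q / T) = -(n / T * q) by ring]
  ring

theorem hasDerivAt_complex_arctan {z : ℂ} (hz : z.re ≠ 0 ∨ |z.im| < 1) :
    HasDerivAt Complex.arctan (1 / (1 + z ^ 2)) z := by
  have h1 : 1 + z * Complex.I ≠ 0 := fun h => by
    have hre := congrArg Complex.re h
    have him := congrArg Complex.im h
    simp at hre him
    rcases hz with hz | hz
    · exact hz him
    · rw [abs_lt] at hz; linarith
  have h2 : 1 - z * Complex.I ≠ 0 := fun h => by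
    have hre := congrArg Complex.re h
    have him := congrArg Complex.im h
    simp at hre him
    rcases hz with hz | hz
    · exact hz him
    · rw [abs_lt] at hz; linarith
  have hslit : (1 + z * Complex.I) / (1 - z * Complex.I) ∈ Complex.slitPlane := by
    have hN : 0 < Complex.normSq (1 - z * Complex.I) := Complex.normSq_pos.2 h2
    rw [Complex.mem_slitPlane_iff, Complex.div_re, Complex.div_im, ← add_div, ← sub_div]
    by_cases hre : z.re = 0
    · have him : |z.im| < 1 := hz.resolve_left (not_not.2 hre)
      rw [abs_lt] at him
      left
      refine div_pos ?_ hN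
      simp [hre]
      nlinarith
    · right
      refine div_ne_zero ?_ hN.ne'
      simp
      contrapose hre
      linarith
  have hnum : HasDerivAt (fun w : ℂ => 1 + w * Complex.I) Complex.I z := by
    simpa using ((hasDerivAt_id z).mul_const Complex.I).const_add 1
  have hden : HasDerivAt (fun w : ℂ => 1 - w * Complex.I) (-Complex.I) z := by
    simpa using ((hasDerivAt_id z).mul_const Complex.I).const_sub 1
  have h := ((hnum.div hden h2).clog hslit).const_mul (-Complex.I / 2)
  have h3 : 1 + z ^ 2 = (1 + z * Complex.I) * (1 - z * Complex.I) := by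
    linear_combination z ^ 2 * Complex.I_sq
  refine h.congr_deriv ?_
  rw [h3]
  have huv : Complex.I * (1 - z * Complex.I) - (1 + z * Complex.I) * -Complex.I =
      2 * Complex.I := by ring
  simp only [Pi.div_apply]
  rw [huv]
  generalize 1 + z * Complex.I = u at h1 ⊢
  generalize 1 - z * Complex.I = v at h2 ⊢
  field_simp
  linear_combination (-1 : ℂ) * Complex.I_sq

/-- Angular average of the resolvent of free transport. -/
theorem integral_inv_add_I_mul {s : ℂ} {a : ℝ} (ha : a ≠ 0)
    (hs : ∀ x ∈ Icc (-1 : ℝ) 1, s + Complex.I * a * x ≠ 0) :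
    ∫ x in (-1 : ℝ)..1, (s + Complex.I * a * x)⁻¹ = 2 * ((a : ℂ)⁻¹ * Complex.arctan (a / s)) := by
  have hac : (a : ℂ) ≠ 0 := Complex.ofReal_ne_zero.2 ha
  have hs0 : s ≠ 0 := by simpa using hs 0 (by norm_num)
  have hs' : ∀ x ∈ Icc (-1 : ℝ) 1, s - Complex.I * a * x ≠ 0 := fun x hx => by
    have := hs (-x) ⟨by linarith [hx.2], by linarith [hx.1]⟩
    push_cast at this
    rwa [mul_neg, ← sub_eq_add_neg] at this
  have hreg : ∀ x ∈ Icc (-1 : ℝ) 1, ((a : ℂ) * x / s).re ≠ 0 ∨ |((a : ℂ) * x / s).im| < 1 := by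
    intro x hx
    by_contra! h
    obtain ⟨hre, him⟩ := h
    set y := ((a : ℂ) * x / s).im with hy
    have hy0 : y ≠ 0 := fun h0 => by rw [h0] at him; norm_num at him
    have hz : (a : ℂ) * x / s = y * Complex.I := by
      apply Complex.ext <;> simp [hre, hy]
    have habs : |x / y| ≤ 1 := by
      rw [abs_div, div_le_one (abs_pos.2 hy0)]
      exact (abs_le.2 hx).trans him
    refine hs (x / y) (abs_le.1 habs) ?_
    have hyc : (y : ℂ) ≠ 0 := Complex.ofReal_ne_zero.2 hy0
    rw [div_eq_iff hs0] at hz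
    push_cast
    field_simp
    linear_combination Complex.I * hz + y * s * Complex.I_sq
  have hderiv : ∀ x ∈ uIcc (0 : ℝ) 1,
      HasDerivAt (fun x : ℝ => 2 * ((a : ℂ)⁻¹ * Complex.arctan (a * x / s)))
        ((s - Complex.I * a * x)⁻¹ + (s + Complex.I * a * x)⁻¹) x := by
    intro x hx
    rw [uIcc_of_le zero_le_one] at hx
    have hx' : x ∈ Icc (-1 : ℝ) 1 := ⟨by linarith [hx.1], hx.2⟩
    have hlin : HasDerivAt (fun x : ℝ => (a : ℂ) * x / s) (a / s) x := by
      simpa using ((Complex.ofRealCLM.hasDerivAt (x := x)).const_mul (a : ℂ)).div_const s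
    have h := (((hasDerivAt_complex_arctan (hreg x hx')).comp x hlin).const_mul
      (a : ℂ)⁻¹).const_mul 2
    refine h.congr_deriv ?_
    have e1 := hs x hx'
    have e2 := hs' x hx'
    have e3 : 1 + ((a : ℂ) * x / s) ^ 2 =
        (s - Complex.I * a * x) * (s + Complex.I * a * x) / s ^ 2 := by
      field_simp
      linear_combination (a : ℂ) ^ 2 * x ^ 2 * Complex.I_sq
    rw [e3]
    have hpq : (s - Complex.I * a * x) + (s + Complex.I * a * x) = 2 * s := by ring
    clear h e3 hs hs' hreg
    generalize s + Complex.I * a * x = q at e1 hpq ⊢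
    generalize s - Complex.I * a * x = p at e2 hpq ⊢
    field_simp
    linear_combination -hpq
  have hc1 : ContinuousOn (fun x : ℝ => (s + Complex.I * a * x)⁻¹) (Icc (-1) 1) :=
    ContinuousOn.inv₀ (by fun_prop) hs
  have hc2 : ContinuousOn (fun x : ℝ => (s - Complex.I * a * x)⁻¹) (Icc (-1) 1) :=
    ContinuousOn.inv₀ (by fun_prop) hs'
  have hi : ∀ {f : ℝ → ℂ} {b c : ℝ}, ContinuousOn f (Icc (-1) 1) → b ∈ Icc (-1 : ℝ) 1 →
      c ∈ Icc (-1 : ℝ) 1 → IntervalIntegrable f volume b c := fun hf hb hc =>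
    (hf.mono (uIcc_subset_Icc hb hc)).intervalIntegrable
  have m0 : (0 : ℝ) ∈ Icc (-1 : ℝ) 1 := by norm_num
  have m1 : (1 : ℝ) ∈ Icc (-1 : ℝ) 1 := by norm_num
  have m2 : (-1 : ℝ) ∈ Icc (-1 : ℝ) 1 := by norm_num
  have hrefl : ∫ x in (-1 : ℝ)..0, (s + Complex.I * a * x)⁻¹ =
      ∫ x in (0 : ℝ)..1, (s - Complex.I * a * x)⁻¹ := by
    have := intervalIntegral.integral_comp_neg (a := 0) (b := 1)
      (fun x : ℝ => (s + Complex.I * a * x)⁻¹)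
    rw [neg_zero] at this
    rw [← this]
    simp [sub_eq_add_neg]
  rw [← intervalIntegral.integral_add_adjacent_intervals (hi hc1 m2 m0) (hi hc1 m0 m1), hrefl,
    ← intervalIntegral.integral_add (hi hc2 m0 m1) (hi hc1 m0 m1),
    intervalIntegral.integral_eq_sub_of_hasDerivAt hderiv
      ((hi hc2 m0 m1).add (hi hc1 m0 m1))]
  simp [Complex.arctan]

theorem integral_sphere_of_transport {s C : ℂ} {a : ℝ} (ha : a ≠ 0)
    (hs : ∀ x ∈ Icc (-1 : ℝ) 1, s + Complex.I * a * x ≠ 0)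
    {φ : Metric.sphere (0 : R3) 1 → ℂ}
    (hφ : ∀ᵐ Ω : Metric.sphere (0 : R3) 1 ∂(volume : Measure R3).toSphere,
      (s + Complex.I * a * ((Ω : R3) 0 : ℝ)) * φ Ω = C) :
    ∫ Ω, φ Ω ∂(volume : Measure R3).toSphere =
      4 * π * (C * ((a : ℂ)⁻¹ * Complex.arctan (a / s))) := by
  have hm : StronglyMeasurable (fun x : ℝ => C * (s + Complex.I * a * x)⁻¹) :=
    Measurable.stronglyMeasurable (by fun_prop)
  have h := integral_sphere_coord hm
  rw [intervalIntegral.integral_const_mul, integral_inv_add_I_mul ha hs] at h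
  have hcongr : ∫ Ω, φ Ω ∂(volume : Measure R3).toSphere =
      ∫ Ω : Metric.sphere (0 : R3) 1, C * (s + Complex.I * a * ((Ω : R3) 0 : ℝ))⁻¹
        ∂(volume : Measure R3).toSphere := by
    refine integral_congr_ae ?_
    filter_upwards [hφ] with Ω hΩ
    rw [← hΩ, mul_comm, inv_mul_cancel_left₀ (hs _ (sphere_coord_mem_Icc Ω))]
  rw [hcongr, h, Complex.real_smul]
  push_cast
  ring

theorem eq_zero_of_transport_resonant {s C : ℂ} {a x₀ : ℝ} (ha : a ≠ 0)
    (hx₀ : x₀ ∈ Icc (-1 : ℝ) 1) (hs : s + Complex.I * a * x₀ = 0)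
    {φ : Metric.sphere (0 : R3) 1 → ℂ} (hfin : Integrable φ (volume : Measure R3).toSphere)
    (hφ : ∀ᵐ Ω : Metric.sphere (0 : R3) 1 ∂(volume : Measure R3).toSphere,
      (s + Complex.I * a * ((Ω : R3) 0 : ℝ)) * φ Ω = C) :
    C = 0 ∧ ∫ Ω, φ Ω ∂(volume : Measure R3).toSphere = 0 := by
  have hac : (a : ℂ) ≠ 0 := Complex.ofReal_ne_zero.2 ha
  have hs' : ∀ x : ℝ, s + Complex.I * a * x = Complex.I * a * ((x - x₀ : ℝ) : ℂ) := fun x => by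
    push_cast
    linear_combination hs
  have hcont : Continuous (fun Ω : Metric.sphere (0 : R3) 1 => (Ω : R3) 0) := by fun_prop
  have hne : ∀ᵐ Ω : Metric.sphere (0 : R3) 1 ∂(volume : Measure R3).toSphere,
      (Ω : R3) 0 ≠ x₀ := by
    refine ae_of_ae_map (p := fun x => x ≠ x₀) hcont.aemeasurable ?_
    rw [map_coord_toSphere]
    exact Measure.ae_smul_measure (ae_restrict_of_ae (Measure.ae_ne volume x₀)) _
  have hC : C = 0 := by
    by_contra hC
    have hm : StronglyMeasurable (fun x : ℝ => (x - x₀)⁻¹) :=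
      Measurable.stronglyMeasurable (by fun_prop)
    have hi : Integrable (fun Ω : Metric.sphere (0 : R3) 1 => ((Ω : R3) 0 - x₀)⁻¹)
        (volume : Measure R3).toSphere := by
      refine ((hfin.const_mul (Complex.I * a / C)).re).congr ?_
      filter_upwards [hφ, hne] with Ω hΩ hΩ'
      have h0 : (((Ω : R3) 0 - x₀ : ℝ) : ℂ) ≠ 0 := Complex.ofReal_ne_zero.2 (sub_ne_zero.2 hΩ')
      have : Complex.I * a / C * φ Ω = (((Ω : R3) 0 - x₀)⁻¹ : ℝ) := by
        rw [hs'] at hΩ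
        rw [Complex.ofReal_inv]
        field_simp
        linear_combination hΩ
      rw [this]
      exact Complex.ofReal_re _
    have := intervalIntegrable_sub_inv_iff.1
      (intervalIntegrable_of_integrable_sphere_coord hm hi)
    rw [uIcc_of_le (by norm_num)] at this
    exact this.elim (by norm_num) fun h => h hx₀
  refine ⟨hC, integral_eq_zero_of_ae ?_⟩
  filter_upwards [hφ, hne] with Ω hΩ hΩ'
  rw [hs', hC] at hΩ
  refine (mul_eq_zero.1 hΩ).resolve_left ?_
  exact mul_ne_zero (mul_ne_zero Complex.I_ne_zero hac)
    (Complex.ofReal_ne_zero.2 (sub_ne_zero.2 hΩ'))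

theorem ae_transport {T τ ϖ k : ℝ} (hT : 0 < T) (hτ : 0 < τ) {ω δT : ℂ} {δf : R3 → ℂ}
    (hδf : Measurable δf)
    (hboltz : ∀ᵐ p : R3, -Complex.I * (ω - (k : ℂ) * ((p 0 / ‖p‖ : ℝ) : ℂ)) * δf p =
      coll (fun _ => (1 - ϖ) / τ) (fun _ => ϖ / τ) T δT δf p)
    (hfin : Integrable (fun p : R3 => wgt T ‖p‖ * ‖δf p‖ ^ 2)) :
    ∀ᵐ r : Ioi (0 : ℝ) ∂Measure.volumeIoiPow 2,
      Integrable (fun Ω : Metric.sphere (0 : R3) 1 => δf ((r : ℝ) • (Ω : R3)))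
        (volume : Measure R3).toSphere ∧
      ∀ᵐ Ω : Metric.sphere (0 : R3) 1 ∂(volume : Measure R3).toSphere,
        ((1 - Complex.I * ω * τ) + Complex.I * (k * τ : ℝ) * ((Ω : R3) 0 : ℝ)) *
            δf ((r : ℝ) • (Ω : R3)) =
          (1 - ϖ) * δfBB T δT r + ϖ * sphAvg δf r := by
  have hnorm : ∀ (r : Ioi (0 : ℝ)) (Ω : Metric.sphere (0 : R3) 1), ‖(r : ℝ) • (Ω : R3)‖ = r :=
    fun r Ω => by rw [norm_smul, norm_eq_of_mem_sphere, mul_one, Real.norm_of_nonneg r.2.le]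
  filter_upwards [ae_polar hboltz, integrable_polar hfin] with r hr hi
  have hr0 : (0 : ℝ) < r := r.2
  constructor
  · have hw : wgt T r ≠ 0 := by
      have := fBB_mul_one_add_pos hr0 hT
      unfold wgt
      positivity
    simp only [hnorm] at hi
    have hm : Measurable (fun Ω : Metric.sphere (0 : R3) 1 => δf ((r : ℝ) • (Ω : R3))) :=
      hδf.comp (by fun_prop)
    have hi2 : Integrable (fun Ω : Metric.sphere (0 : R3) 1 => ‖δf ((r : ℝ) • (Ω : R3))‖ ^ 2)
        (volume : Measure R3).toSphere := by
      refine (hi.const_mul (wgt T r)⁻¹).congr (.of_forall fun Ω => ?_)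
      exact inv_mul_cancel_left₀ hw _
    exact ((memLp_two_iff_integrable_sq_norm hm.aestronglyMeasurable).2 hi2).integrable
      one_le_two
  · filter_upwards [hr] with Ω hΩ
    have hμ : ((r : ℝ) • (Ω : R3)) 0 / (r : ℝ) = (Ω : R3) 0 := by
      rw [PiLp.smul_apply, smul_eq_mul, mul_div_cancel_left₀ _ hr0.ne']
    rw [coll, hnorm, hμ] at hΩ
    have hτc : (τ : ℂ) ≠ 0 := Complex.ofReal_ne_zero.2 hτ.ne'
    push_cast at hΩ ⊢
    field_simp at hΩ
    linear_combination hΩ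

theorem energy_balance {T cM τ ϖ : ℝ} (hT : 0 < T) {ω δT κ : ℂ} (hδT : δT ≠ 0) {δf : R3 → ℂ}
    (henergy : -Complex.I * cM * ω * δT =
      -∫ p : R3, ((2 / (2 * Real.pi) ^ 3 * ‖p‖ : ℝ) : ℂ) *
        coll (fun _ => (1 - ϖ) / τ) (fun _ => ϖ / τ) T δT δf p)
    (hfin : Integrable (fun p : R3 => ((2 / (2 * Real.pi) ^ 3 * ‖p‖ : ℝ) : ℂ) *
      coll (fun _ => (1 - ϖ) / τ) (fun _ => ϖ / τ) T δT δf p))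
    (hray : ∀ᵐ r : Ioi (0 : ℝ) ∂Measure.volumeIoiPow 2,
      Integrable (fun Ω : Metric.sphere (0 : R3) 1 => δf ((r : ℝ) • (Ω : R3)))
        (volume : Measure R3).toSphere)
    (havg : ∀ᵐ r : Ioi (0 : ℝ) ∂Measure.volumeIoiPow 2, sphAvg δf r = κ * δfBB T δT r) :
    cM * ω = -Complex.I * ((4 * π ^ 2 * T ^ 3 / 15 : ℝ) : ℂ) / τ * (1 - ϖ : ℝ) * (1 - κ) := by
  have hnorm : ∀ (r : Ioi (0 : ℝ)) (Ω : Metric.sphere (0 : R3) 1), ‖(r : ℝ) • (Ω : R3)‖ = r :=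
    fun r Ω => by rw [norm_smul, norm_eq_of_mem_sphere, mul_one, Real.norm_of_nonneg r.2.le]
  have hπ : (π : ℂ) ≠ 0 := Complex.ofReal_ne_zero.2 Real.pi_ne_zero
  have hTc : (T : ℂ) ≠ 0 := Complex.ofReal_ne_zero.2 hT.ne'
  have harea : (volume : Measure R3).toSphere.real univ = 4 * π := by
    have := sphere_moment 0
    simp only [pow_zero, integral_const, intervalIntegral.integral_const, smul_eq_mul,
      mul_one] at this
    rw [this]
    ring
  set D : ℂ := (1 - ϖ : ℝ) / τ * (1 - κ) * δT / (π ^ 2 * T ^ 2 : ℝ) with hD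
  have hsphere : ∀ᵐ r : Ioi (0 : ℝ) ∂Measure.volumeIoiPow 2,
      ∫ Ω : Metric.sphere (0 : R3) 1, ((2 / (2 * Real.pi) ^ 3 * ‖(r : ℝ) • (Ω : R3)‖ : ℝ) : ℂ) *
        coll (fun _ => (1 - ϖ) / τ) (fun _ => ϖ / τ) T δT δf ((r : ℝ) • (Ω : R3))
        ∂(volume : Measure R3).toSphere =
      (((r : ℝ) ^ 2 * (fBB T r * (1 + fBB T r)) : ℝ) : ℂ) * D := by
    filter_upwards [hray, havg] with r hr ha
    have hF : ∫ Ω : Metric.sphere (0 : R3) 1, δf ((r : ℝ) • (Ω : R3))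
        ∂(volume : Measure R3).toSphere = 4 * π * (κ * δfBB T δT r) := by
      rw [← ha, sphAvg, Complex.real_smul]
      push_cast
      field_simp
    have hcoll : ∀ Ω : Metric.sphere (0 : R3) 1,
        ((2 / (2 * Real.pi) ^ 3 * ‖(r : ℝ) • (Ω : R3)‖ : ℝ) : ℂ) *
          coll (fun _ => (1 - ϖ) / τ) (fun _ => ϖ / τ) T δT δf ((r : ℝ) • (Ω : R3)) =
        ((2 / (2 * Real.pi) ^ 3 * r : ℝ) : ℂ) *
          (((((1 - ϖ) / τ : ℝ) : ℂ) + ((ϖ / τ : ℝ) : ℂ) * κ) * δfBB T δT r -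
            ((1 / τ : ℝ) : ℂ) * δf ((r : ℝ) • (Ω : R3))) := fun Ω => by
      rw [coll, hnorm, ha]
      push_cast
      ring
    simp only [hcoll]
    rw [integral_const_mul, integral_sub (integrable_const _) (hr.const_mul _), integral_const,
      integral_const_mul, hF, harea, Complex.real_smul, hD, δfBB]
    push_cast
    field_simp
    ring
  have hmoment : ∫ q in Ioi (0 : ℝ), (q ^ 2 : ℝ) •
      (((q ^ 2 * (fBB T q * (1 + fBB T q)) : ℝ) : ℂ) * D) =
      ((4 * π ^ 4 / 15 * T ^ 5 : ℝ) : ℂ) * D := by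
    rw [← integral_pow_four_mul_fBB hT, ← integral_complex_ofReal, ← integral_mul_const]
    congr 1
    ext q
    rw [Complex.real_smul]
    push_cast
    ring
  rw [integral_polar hfin, integral_congr_ae hsphere,
    integral_volumeIoiPow 2 (fun q => ((q ^ 2 * (fBB T q * (1 + fBB T q)) : ℝ) : ℂ) * D),
    hmoment, hD] at henergy
  refine mul_right_cancel₀ hδT (mul_left_cancel₀ (neg_ne_zero.2 Complex.I_ne_zero) ?_)
  rw [← mul_assoc, ← mul_assoc, henergy]
  push_cast
  field_simp
  rw [Complex.I_sq]
  ring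

theorem grey_dispersion_relation
    (T cM τ ϖ : ℝ) (hT : 0 < T) (hcM : 0 < cM) (hτ : 0 < τ) (hϖ : ϖ ∈ Icc (0 : ℝ) 1)
    (k : ℝ) (hk : k ≠ 0) (ω : ℂ) (hω : (ω * (τ : ℂ)).im < 1)
    (δT : ℂ) (hδT : δT ≠ 0) (δf : R3 → ℂ) (hδf : Measurable δf)
    -- equation (i): energy conservation, with σ_A ≡ (1−ϖ)/τ and σ_S ≡ ϖ/τ
    (heq1 : -Complex.I * cM * ω * δT =
      -∫ p : R3, ((2 / (2 * Real.pi) ^ 3 * ‖p‖ : ℝ) : ℂ) *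
        coll (fun _ => (1 - ϖ) / τ) (fun _ => ϖ / τ) T δT δf p)
    -- equation (ii): Boltzmann equation, for a.e. p
    (heq2 : ∀ᵐ p : R3, -Complex.I * (ω - (k : ℂ) * ((p 0 / ‖p‖ : ℝ) : ℂ)) * δf p =
      coll (fun _ => (1 - ϖ) / τ) (fun _ => ϖ / τ) T δT δf p)
    -- finiteness assumptions
    (hInt1 : Integrable (fun p : R3 => wgt T ‖p‖ * ‖δf p‖ ^ 2))
    (hInt2 : Integrable (fun p : R3 =>
      wgt T ‖p‖ * ((1 - ϖ) / τ) * ‖δfBB T δT ‖p‖ - δf p‖ ^ 2))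
    (hInt3 : Integrable (fun p : R3 => wgt T ‖p‖ * (ϖ / τ) * ‖sphAvg δf ‖p‖ - δf p‖ ^ 2))
    (hInt4 : Integrable (fun p : R3 => ((2 / (2 * Real.pi) ^ 3 * ‖p‖ : ℝ) : ℂ) *
      coll (fun _ => (1 - ϖ) / τ) (fun _ => ϖ / τ) T δT δf p))
    -- nonvanishing denominator
    (hden : 1 - ((ϖ : ℂ) / (k * τ : ℝ)) *
      Complex.arctan ((k * τ : ℝ) / (1 - Complex.I * ω * (τ : ℂ))) ≠ 0) :
    ω = -Complex.I * ((4 * Real.pi ^ 2 * T ^ 3 / 15 / cM : ℝ) : ℂ) / (τ : ℂ) *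
        ((1 - ϖ : ℝ) : ℂ) *
        (1 - ((k * τ : ℝ) : ℂ)⁻¹ *
          Complex.arctan ((k * τ : ℝ) / (1 - Complex.I * ω * (τ : ℂ)))) /
        (1 - ((ϖ : ℂ) / (k * τ : ℝ)) *
          Complex.arctan ((k * τ : ℝ) / (1 - Complex.I * ω * (τ : ℂ)))) := by
  have hkτ : k * τ ≠ 0 := mul_ne_zero hk hτ.ne'
  have hcMc : (cM : ℂ) ≠ 0 := Complex.ofReal_ne_zero.2 hcM.ne'
  have hray := ae_transport hT hτ hδf heq2 hInt1
  have hray' := hray.mono fun _ h => h.1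
  by_cases hs : ∀ x ∈ Icc (-1 : ℝ) 1, 1 - Complex.I * ω * τ + Complex.I * (k * τ : ℝ) * x ≠ 0
  · rw [div_eq_mul_inv (ϖ : ℂ), mul_assoc (ϖ : ℂ)] at hden ⊢
    set A : ℂ := ((k * τ : ℝ) : ℂ)⁻¹ *
      Complex.arctan ((k * τ : ℝ) / (1 - Complex.I * ω * (τ : ℂ))) with hA
    have havg : ∀ᵐ r : Ioi (0 : ℝ) ∂Measure.volumeIoiPow 2,
        sphAvg δf r = (1 - ϖ) * A / (1 - ϖ * A) * δfBB T δT r := by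
      filter_upwards [hray] with r hr
      have h := integral_sphere_of_transport hkτ hs hr.2
      rw [← hA] at h
      have hF : sphAvg δf r = ((1 - ϖ) * δfBB T δT r + ϖ * sphAvg δf r) * A := by
        have hπ : (π : ℂ) ≠ 0 := Complex.ofReal_ne_zero.2 Real.pi_ne_zero
        conv_lhs => rw [sphAvg, h, Complex.real_smul]
        push_cast
        field_simp
      rw [div_mul_eq_mul_div, eq_div_iff hden]
      linear_combination hF
    have h := energy_balance hT hδT heq1 hInt4 hray' havg
    refine mul_left_cancel₀ hcMc (h.trans ?_)
    have hκ : 1 - (1 - ϖ) * A / (1 - ϖ * A) = (1 - A) / (1 - ϖ * A) := by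
      rw [eq_div_iff hden, sub_mul, div_mul_cancel₀ _ hden]
      ring
    rw [hκ]
    push_cast
    field_simp
  · exfalso
    push Not at hs
    obtain ⟨x₀, hx₀, hres⟩ := hs
    have hzero : ∀ᵐ r : Ioi (0 : ℝ) ∂Measure.volumeIoiPow 2,
        sphAvg δf r = 0 * δfBB T δT r ∧ (1 - ϖ) * δfBB T δT r = 0 := by
      filter_upwards [hray] with r hr
      obtain ⟨hC, hF⟩ := eq_zero_of_transport_resonant hkτ hx₀ hres hr.1 hr.2
      have hF' : sphAvg δf r = 0 := by rw [sphAvg, hF, smul_zero]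
      rw [hF', mul_zero, add_zero] at hC
      exact ⟨by rw [hF', zero_mul], hC⟩
    have hne : Measure.volumeIoiPow 2 ≠ 0 := fun h => by
      have := Measure.volumeIoiPow_apply_Iio 2 ⟨1, mem_Ioi.2 one_pos⟩
      rw [h] at this
      norm_num at this
    have := ae_neBot.2 hne
    obtain ⟨r, -, hr⟩ := hzero.exists
    have hϖ1 : (1 - ϖ : ℂ) = 0 := by
      refine (mul_eq_zero.1 hr).resolve_right (mul_ne_zero ?_ hδT)
      have hr0 : (0 : ℝ) < r := r.2
      have := fBB_mul_one_add_pos hr0 hT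
      exact Complex.ofReal_ne_zero.2 (by positivity)
    have h := energy_balance hT hδT heq1 hInt4 hray' (hzero.mono fun _ h => h.1)
    rw [Complex.ofReal_sub, Complex.ofReal_one, hϖ1, mul_zero, zero_mul, mul_eq_zero] at h
    rw [h.resolve_left hcMc] at hres
    simpa using congrArg Complex.re hres
end
end
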